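/- Let r, n ∈ ℕ and suppose the generating polynomial P_n ∈ Π_n satisfies: (a) P_n^{(ν)}(x) ≥ 0 for all x ∈ [0,1] and all 0 ≤ ν ≤ r, and (b) ∫₀¹ P_n(t) dt = 1. Then the Gavrea operator H_{n+2} : C[0,1] → Π_{n+2} satisfies: (i) H_{n+2} is a positive linear operator and H_{n+2}(P_n; g, ·) = g for every g ∈ Π_1; (ii) H_{n+2}(P_n; e₂, x) = x² + x(1−x)(1 − ∫₀¹ t² P_n(t) dt); (iii) for every 0 ≤ k ≤ r+1, H_{n+2} preserves k-monotonicity, i.e. if f ∈ Δ^{(k)} then H_{n+2}(P_n; f, ·) ∈ Δ^{(k)}. -/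

import Mathlib

noncomputable section

open Set Finset
open scoped Classical

/-- The interval `[0,1]`. -/
def I01 : Set ℝ := Set.Icc 0 1

/-- `φ(x) = √(x(1-x))`. -/
def phi (x : ℝ) : ℝ := Real.sqrt (x * (1 - x))

/-- The `k`-th symmetric difference of `f` with step `δ`. -/
def centralDiff (k : ℕ) (δ : ℝ) (f : ℝ → ℝ) (x : ℝ) : ℝ :=
  if (x - k * δ / 2) ∈ I01 ∧ (x + k * δ / 2) ∈ I01 then
    ∑ i ∈ Finset.range (k + 1),
      (k.choose i : ℝ) * (-1 : ℝ) ^ (k - i) * f (x - k * δ / 2 + i * δ)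
  else 0

/-- The second Ditzian–Totik modulus of smoothness with step-weight `ψ`. -/
def omega2 (ψ : ℝ → ℝ) (f : ℝ → ℝ) (t : ℝ) : ℝ :=
  sSup {v : ℝ | ∃ s x : ℝ, 0 < s ∧ s ≤ t ∧ x ∈ I01 ∧ v = |centralDiff 2 (s * ψ x) f x|}

/-- `f` is `k`-monotone on `[0,1]`. -/
def kMono (k : ℕ) (f : ℝ → ℝ) : Prop :=
  ∀ δ : ℝ, 0 < δ → ∀ x ∈ I01, 0 ≤ centralDiff k δ f x

/-- `g` coincides (on all of `ℝ`) with an algebraic polynomial of degree at most `n`. -/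
def IsPolyOfDegLe (n : ℕ) (g : ℝ → ℝ) : Prop :=
  ∃ p : Polynomial ℝ, p.natDegree ≤ n ∧ ∀ x, g x = p.eval x

/-- `L` is a positive linear operator `C[0,1] → C[0,1]`. -/
def PositiveLinearOp (L : (ℝ → ℝ) → (ℝ → ℝ)) : Prop :=
  (∀ f g : ℝ → ℝ, ContinuousOn f I01 → ContinuousOn g I01 →
      ∀ x ∈ I01, L (fun y => f y + g y) x = L f x + L g x) ∧
  (∀ (a : ℝ) (f : ℝ → ℝ), ContinuousOn f I01 →
      ∀ x ∈ I01, L (fun y => a * f y) x = a * L f x) ∧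
  (∀ f : ℝ → ℝ, ContinuousOn f I01 → ContinuousOn (L f) I01) ∧
  (∀ f : ℝ → ℝ, ContinuousOn f I01 → (∀ x ∈ I01, 0 ≤ f x) → ∀ x ∈ I01, 0 ≤ L f x)

/-- The Bernstein fundamental polynomials `p_{n,k}(x) = C(n,k) x^k (1-x)^{n-k}`. -/
def bern (n k : ℕ) (x : ℝ) : ℝ := (n.choose k : ℝ) * x ^ k * (1 - x) ^ (n - k)

/-- The genuine Bernstein–Durrmeyer (Goodman–Sharma) operator `U_n`. -/
def Uop (n : ℕ) (f : ℝ → ℝ) (x : ℝ) : ℝ :=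
  f 0 * (1 - x) ^ n + f 1 * x ^ n +
    ((n : ℝ) - 1) * ∑ k ∈ Finset.Icc 1 (n - 1),
      bern n k x * ∫ t in (0 : ℝ)..1, bern (n - 2) (k - 1) t * f t

/-- Gavrea's operator `H_{n+2}` with generating polynomial `P`. -/
def Hop (n : ℕ) (P : Polynomial ℝ) (f : ℝ → ℝ) (x : ℝ) : ℝ :=
  ∑ k ∈ Finset.range (n + 1), P.coeff k / ((k : ℝ) + 1) * Uop (k + 2) f x

/-- Trigonometric moments `∫₀^π (2 cos θ)^(2i) (2 sin θ)^(2α) dθ`, with super Catalan values. -/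
lemma integral_two_cos_pow_even_mul_two_sin_pow (α i : ℕ) :
    ∫ θ in (0 : ℝ)..Real.pi, (2 * Real.cos θ) ^ (2 * i) * (2 * Real.sin θ) ^ (2 * α) =
      Real.pi * ((2 * i).factorial * (2 * α).factorial) /
        (i.factorial * α.factorial * (α + i).factorial) := by
  induction α generalizing i with
  | zero =>
    simp only [mul_zero, pow_zero, mul_one]
    induction i with
    | zero => simp
    | succ i ih =>
      have h1 : ∀ j : ℕ, ∫ θ in (0 : ℝ)..Real.pi, (2 * Real.cos θ) ^ j =
          2 ^ j * ∫ θ in (0 : ℝ)..Real.pi, Real.cos θ ^ j := by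
        intro j
        simp_rw [mul_pow]
        exact intervalIntegral.integral_const_mul _ _
      rw [h1] at ih ⊢
      rw [show 2 * (i + 1) = 2 * i + 2 by ring, integral_cos_pow]
      have h2 : (2 : ℝ) ^ (2 * i + 2) = 4 * 2 ^ (2 * i) := by ring
      rw [h2]
      simp only [Real.sin_pi, Real.sin_zero, mul_zero, sub_zero, zero_div, zero_add]
      have h3 : (4 : ℝ) * 2 ^ (2 * i) * (((2 * i : ℕ) + 1) / ((2 * i : ℕ) + 2) *
          ∫ θ in (0 : ℝ)..Real.pi, Real.cos θ ^ (2 * i)) =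
          4 * (((2 * i : ℕ) + 1) / ((2 * i : ℕ) + 2)) *
          (2 ^ (2 * i) * ∫ θ in (0 : ℝ)..Real.pi, Real.cos θ ^ (2 * i)) := by ring
      rw [h3, ih]
      simp only [Nat.factorial_succ, Nat.zero_add, Nat.factorial_zero]
      push_cast
      have : (i.factorial : ℝ) ≠ 0 := by positivity
      field_simp
      ring
  | succ α ih =>
    have h : ∀ θ : ℝ, (2 * Real.cos θ) ^ (2 * i) * (2 * Real.sin θ) ^ (2 * (α + 1)) =
        4 * ((2 * Real.cos θ) ^ (2 * i) * (2 * Real.sin θ) ^ (2 * α)) -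
          (2 * Real.cos θ) ^ (2 * (i + 1)) * (2 * Real.sin θ) ^ (2 * α) := by
      intro θ
      have h1 : (2 * Real.sin θ) ^ 2 = 4 - (2 * Real.cos θ) ^ 2 := by
        rw [mul_pow, mul_pow, Real.sin_sq]; ring
      rw [show 2 * (α + 1) = 2 * α + 2 by ring, show 2 * (i + 1) = 2 * i + 2 by ring, pow_add,
        pow_add, h1]
      ring
    simp_rw [h]
    rw [intervalIntegral.integral_sub (by apply Continuous.intervalIntegrable; fun_prop)
      (by apply Continuous.intervalIntegrable; fun_prop), intervalIntegral.integral_const_mul,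
      ih, ih, show 2 * (α + 1) = 2 * α + 2 by ring, show 2 * (i + 1) = 2 * i + 2 by ring,
      show α + 1 + i = α + i + 1 by ring, show α + (i + 1) = α + i + 1 by ring]
    simp only [Nat.factorial_succ]
    push_cast
    have h1 : (i.factorial : ℝ) ≠ 0 := by positivity
    have h2 : (α.factorial : ℝ) ≠ 0 := by positivity
    have h3 : ((α + i).factorial : ℝ) ≠ 0 := by positivity
    field_simp
    ring

lemma integral_two_cos_pow_odd_mul_two_sin_pow (α i : ℕ) :
    ∫ θ in (0 : ℝ)..Real.pi, (2 * Real.cos θ) ^ (2 * i + 1) * (2 * Real.sin θ) ^ (2 * α) = 0 := by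
  have h := intervalIntegral.integral_comp_sub_left (a := 0) (b := Real.pi)
    (fun θ => (2 * Real.cos θ) ^ (2 * i + 1) * (2 * Real.sin θ) ^ (2 * α)) Real.pi
  simp only [sub_self, sub_zero, Real.cos_pi_sub, Real.sin_pi_sub] at h
  have h1 : ∀ θ : ℝ, (2 * -Real.cos θ) ^ (2 * i + 1) * (2 * Real.sin θ) ^ (2 * α) =
      -((2 * Real.cos θ) ^ (2 * i + 1) * (2 * Real.sin θ) ^ (2 * α)) := by
    intro θ
    rw [mul_neg, Odd.neg_pow ⟨i, rfl⟩]; ring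
  simp_rw [h1] at h
  rw [intervalIntegral.integral_neg] at h
  linarith

/-- A homogeneous Gegenbauer-type polynomial in two variables. -/
def gegSum (N α : ℕ) (a b : ℝ) : ℝ :=
  ∑ j ∈ Finset.range (N + 1), (N.choose j : ℝ) *
    ((N + α).factorial / ((j + α).factorial * (N - j + α).factorial)) * (a ^ j * b ^ (N - j))

/-- A form of the Chu–Vandermonde identity. -/
lemma sum_choose_mul_choose_mul_factorial_div (N j α : ℕ) (hj : j ≤ N) :
    ∑ i ∈ Finset.range (N + 1), (j.choose i : ℝ) * ((N - j).choose i) *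
      (i.factorial / (α + i).factorial) =
    (N + α).factorial / ((j + α).factorial * (N - j + α).factorial) := by
  have hV := Nat.add_choose_eq (N - j) (j + α) j
  rw [Finset.Nat.sum_antidiagonal_eq_sum_range_succ_mk] at hV
  rw [← Finset.sum_subset (Finset.range_mono (Nat.succ_le_succ hj))]
  · have h1 : ∀ i ∈ Finset.range (j + 1), (j.choose i : ℝ) * ((N - j).choose i) *
        (i.factorial / (α + i).factorial) =
        (j.factorial / (j + α).factorial) *
          (((N - j).choose i * (j + α).choose (j - i) : ℕ) : ℝ) := by
      intro i hi
      have hi' : i ≤ j := Nat.lt_succ_iff.mp (Finset.mem_range.mp hi)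
      push_cast
      rw [Nat.cast_choose ℝ hi', Nat.cast_choose ℝ (show j - i ≤ j + α by omega),
        show j + α - (j - i) = α + i by omega]
      have h1 : (i.factorial : ℝ) ≠ 0 := by positivity
      have h2 : ((α + i).factorial : ℝ) ≠ 0 := by positivity
      have h3 : ((j - i).factorial : ℝ) ≠ 0 := by positivity
      have h4 : ((j + α).factorial : ℝ) ≠ 0 := by positivity
      field_simp
    rw [Finset.sum_congr rfl h1, ← Finset.mul_sum, ← Nat.cast_sum, ← hV,
      Nat.cast_choose ℝ (by omega), show N - j + (j + α) = N + α by omega,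
      show N + α - j = N - j + α by omega]
    have h1 : (j.factorial : ℝ) ≠ 0 := by positivity
    field_simp
  · intro i _ hi
    rw [Finset.mem_range, not_lt] at hi
    simp [Nat.choose_eq_zero_of_lt (show j < i by omega)]

lemma choose_mul_choose_mul_factorial (N i j : ℕ) (hij : i ≤ j) (hj : j + i ≤ N) :
    (N.choose (2 * i) : ℝ) * (N - 2 * i).choose (j - i) * (2 * i).factorial / i.factorial =
      N.choose j * (j.choose i * (N - j).choose i * i.factorial) := by
  rw [Nat.cast_choose ℝ (show 2 * i ≤ N by omega),
    Nat.cast_choose ℝ (show j - i ≤ N - 2 * i by omega),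
    Nat.cast_choose ℝ (show j ≤ N by omega), Nat.cast_choose ℝ hij,
    Nat.cast_choose ℝ (show i ≤ N - j by omega),
    show N - 2 * i - (j - i) = N - j - i by omega]
  have h1 : (i.factorial : ℝ) ≠ 0 := by positivity
  have h2 : (j.factorial : ℝ) ≠ 0 := by positivity
  have h3 : ((j - i).factorial : ℝ) ≠ 0 := by positivity
  have h4 : ((N - j).factorial : ℝ) ≠ 0 := by positivity
  have h5 : ((N - j - i).factorial : ℝ) ≠ 0 := by positivity
  have h6 : ((2 * i).factorial : ℝ) ≠ 0 := by positivity
  have h7 : ((N - 2 * i).factorial : ℝ) ≠ 0 := by positivity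
  field_simp

lemma sum_range_two_mul_of_odd_eq_zero (g : ℕ → ℝ) (hg : ∀ i, g (2 * i + 1) = 0) (M : ℕ) :
    ∑ m ∈ Finset.range (2 * M), g m = ∑ i ∈ Finset.range M, g (2 * i) := by
  induction M with
  | zero => simp
  | succ M ih =>
    rw [show 2 * (M + 1) = 2 * M + 1 + 1 by ring, Finset.sum_range_succ, Finset.sum_range_succ, ih,
      hg, Finset.sum_range_succ, add_zero]

/-- Integral representation of `gegSum`. -/
lemma integral_add_cos_pow_mul_sin_pow (N α : ℕ) (a b s : ℝ) (hs : s ^ 2 = a * b) :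
    ∫ θ in (0 : ℝ)..Real.pi, (a + b + s * (2 * Real.cos θ)) ^ N * (2 * Real.sin θ) ^ (2 * α) =
      Real.pi * (2 * α).factorial / α.factorial * gegSum N α a b := by
  have h1 : ∀ θ : ℝ, (a + b + s * (2 * Real.cos θ)) ^ N * (2 * Real.sin θ) ^ (2 * α) =
      ∑ m ∈ Finset.range (2 * (N + 1)), (N.choose m * s ^ m * (a + b) ^ (N - m)) *
        ((2 * Real.cos θ) ^ m * (2 * Real.sin θ) ^ (2 * α)) := by
    intro θ
    rw [add_comm (a + b), add_pow, Finset.sum_mul]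
    rw [Finset.sum_subset (Finset.range_mono (show N + 1 ≤ 2 * (N + 1) by omega))]
    · refine Finset.sum_congr rfl fun m _ => ?_
      rw [mul_pow]; ring
    · intro m _ hm
      rw [Finset.mem_range, not_lt] at hm
      simp [Nat.choose_eq_zero_of_lt (show N < m by omega)]
  simp_rw [h1]
  rw [intervalIntegral.integral_finsetSum
    (fun m _ => by apply Continuous.intervalIntegrable; fun_prop)]
  simp_rw [intervalIntegral.integral_const_mul]
  rw [sum_range_two_mul_of_odd_eq_zero _
    (fun i => by rw [integral_two_cos_pow_odd_mul_two_sin_pow, mul_zero])]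
  simp_rw [integral_two_cos_pow_even_mul_two_sin_pow]
  have h2 : ∀ i ∈ Finset.range (N + 1),
      (N.choose (2 * i) : ℝ) * s ^ (2 * i) * (a + b) ^ (N - 2 * i) *
        (Real.pi * ((2 * i).factorial * (2 * α).factorial) /
          (i.factorial * α.factorial * (α + i).factorial)) =
      ∑ j ∈ Finset.range (N + 1), Real.pi * (2 * α).factorial / α.factorial *
        (N.choose j * ((j.choose i : ℝ) * ((N - j).choose i) *
        (i.factorial / (α + i).factorial)) * (a ^ j * b ^ (N - j))) := by
    intro i _
    by_cases hiN : 2 * i ≤ N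
    · rw [← Finset.sum_subset (s₁ := Finset.Ico i (N - i + 1))]
      · rw [Finset.sum_Ico_eq_sum_range, show N - i + 1 - i = N - 2 * i + 1 by omega, add_pow,
          Finset.mul_sum, Finset.sum_mul]
        refine Finset.sum_congr rfl fun l hl => ?_
        have hl' : l ≤ N - 2 * i := Nat.lt_succ_iff.mp (Finset.mem_range.mp hl)
        have hc := choose_mul_choose_mul_factorial N i (i + l) (by omega) (by omega)
        rw [show i + l - i = l by omega] at hc
        have e1 : b ^ (N - (i + l)) = b ^ i * b ^ (N - 2 * i - l) := by
          rw [← pow_add]; congr 1; omega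
        rw [pow_mul, hs, e1, pow_add, mul_pow]
        calc _ = (N.choose (2 * i) : ℝ) * (N - 2 * i).choose l * (2 * i).factorial / i.factorial *
              (a ^ i * b ^ i * (a ^ l * b ^ (N - 2 * i - l)) *
              (Real.pi * (2 * α).factorial / (α.factorial * (α + i).factorial))) := by
              have h1 : (i.factorial : ℝ) ≠ 0 := by positivity
              field_simp
          _ = _ := by
              rw [hc]
              field_simp
      · intro j hj
        simp only [Finset.mem_Ico, Finset.mem_range] at hj ⊢
        omega
      · intro j hj hj'
        simp only [Finset.mem_Ico, Finset.mem_range] at hj hj'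
        rcases Nat.lt_or_ge j i with h | h
        · simp [Nat.choose_eq_zero_of_lt h]
        · simp [Nat.choose_eq_zero_of_lt (show N - j < i by omega)]
    · rw [Nat.choose_eq_zero_of_lt (by omega), Finset.sum_eq_zero]
      · simp
      · intro j hj
        rw [Finset.mem_range] at hj
        rcases Nat.lt_or_ge j i with h | h
        · simp [Nat.choose_eq_zero_of_lt h]
        · simp [Nat.choose_eq_zero_of_lt (show N - j < i by omega)]
  rw [Finset.sum_congr rfl h2, Finset.sum_comm, gegSum, Finset.mul_sum]
  refine Finset.sum_congr rfl fun j hj => ?_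
  rw [← sum_choose_mul_choose_mul_factorial_div N j α (Nat.lt_succ_iff.mp (Finset.mem_range.mp hj)),
    ← Finset.mul_sum, ← Finset.sum_mul, ← Finset.mul_sum]

/-- A polynomial which is nonnegative on `[0,1]` stays nonnegative when its monomials are replaced
by the polynomials `gegSum` in `xt` and `(1-x)(1-t)`. -/
lemma sum_mul_gegSum_nonneg {ι : Type*} (S : Finset ι) (q : ι → ℝ) (e : ι → ℕ) (α : ℕ)
    (hq : ∀ y ∈ I01, 0 ≤ ∑ i ∈ S, q i * y ^ e i) {x t : ℝ} (hx : x ∈ I01) (ht : t ∈ I01) :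
    0 ≤ ∑ i ∈ S, q i * gegSum (e i) α (x * t) ((1 - x) * (1 - t)) := by
  obtain ⟨hx0, hx1⟩ := hx
  obtain ⟨ht0, ht1⟩ := ht
  have ha : 0 ≤ x * t := mul_nonneg hx0 ht0
  have hb : 0 ≤ (1 - x) * (1 - t) := mul_nonneg (by linarith) (by linarith)
  set a := x * t with ha_def
  set b := (1 - x) * (1 - t) with hb_def
  set s := Real.sqrt (a * b) with hs_def
  have hs0 : 0 ≤ s := Real.sqrt_nonneg _
  have hs : s ^ 2 = a * b := Real.sq_sqrt (mul_nonneg ha hb)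
  have hs1 : 2 * s ≤ a + b := by
    apply abs_le_of_sq_le_sq' _ (by linarith) |>.2
    nlinarith [sq_nonneg (a - b)]
  have hs2 : a + b + 2 * s ≤ 1 := by
    have : 2 * s ≤ 1 - a - b := by
      have h1 : 1 - a - b = x * (1 - t) + t * (1 - x) := by rw [ha_def, hb_def]; ring
      have h2 : 0 ≤ x * (1 - t) := mul_nonneg hx0 (by linarith)
      have h3 : 0 ≤ t * (1 - x) := mul_nonneg ht0 (by linarith)
      have h4 : s ^ 2 = (x * (1 - t)) * (t * (1 - x)) := by rw [hs, ha_def, hb_def]; ring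
      rw [h1]
      apply abs_le_of_sq_le_sq' _ (by linarith) |>.2
      nlinarith [sq_nonneg (x * (1 - t) - t * (1 - x))]
    linarith
  have hc : 0 < Real.pi * (2 * α).factorial / α.factorial := by
    have := Real.pi_pos
    positivity
  have key : 0 ≤ ∫ θ in (0 : ℝ)..Real.pi, ∑ i ∈ S,
      q i * ((a + b + s * (2 * Real.cos θ)) ^ e i * (2 * Real.sin θ) ^ (2 * α)) := by
    refine intervalIntegral.integral_nonneg Real.pi_pos.le fun θ _ => ?_
    simp_rw [← mul_assoc]
    rw [← Finset.sum_mul]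
    refine mul_nonneg (hq _ ⟨?_, ?_⟩) (by rw [pow_mul]; positivity)
    · nlinarith [Real.neg_one_le_cos θ]
    · nlinarith [Real.cos_le_one θ]
  rw [intervalIntegral.integral_finsetSum
    (fun i _ => by apply Continuous.intervalIntegrable; fun_prop)] at key
  simp_rw [intervalIntegral.integral_const_mul,
    integral_add_cos_pow_mul_sin_pow _ α a b s hs] at key
  refine nonneg_of_mul_nonneg_right (a := Real.pi * (2 * α).factorial / α.factorial) ?_ hc
  rw [Finset.mul_sum]
  exact le_of_le_of_eq key (Finset.sum_congr rfl fun i _ => by ring)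

lemma bern_eq_eval (n k : ℕ) (x : ℝ) : bern n k x = (bernsteinPolynomial ℝ n k).eval x := by
  simp [bern, bernsteinPolynomial]

lemma bern_nonneg (n k : ℕ) {x : ℝ} (hx : x ∈ I01) : 0 ≤ bern n k x := by
  obtain ⟨h0, h1⟩ := hx
  have : 0 ≤ 1 - x := by linarith
  unfold bern
  positivity

@[fun_prop]
lemma continuous_bern (n k : ℕ) : Continuous (bern n k) := by
  unfold bern
  fun_prop

/-- The polynomial with Bernstein coefficients `c` in degree `N`. -/
def bernSum (N : ℕ) (c : ℕ → ℝ) : Polynomial ℝ :=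
  ∑ j ∈ Finset.range (N + 1), Polynomial.C (c j) * bernsteinPolynomial ℝ N j

lemma eval_bernSum (N : ℕ) (c : ℕ → ℝ) (x : ℝ) :
    (bernSum N c).eval x = ∑ j ∈ Finset.range (N + 1), c j * bern N j x := by
  simp [bernSum, Polynomial.eval_finsetSum, bern_eq_eval]

lemma natDegree_bernSum_le (N : ℕ) (c : ℕ → ℝ) : (bernSum N c).natDegree ≤ N := by
  refine Polynomial.natDegree_sum_le_of_forall_le _ _ fun j hj => ?_
  have hj' : j ≤ N := Nat.lt_succ_iff.mp (Finset.mem_range.mp hj)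
  refine (Polynomial.natDegree_C_mul_le _ _).trans ?_
  unfold bernsteinPolynomial
  have h2 : ((1 : Polynomial ℝ) - Polynomial.X).natDegree ≤ 1 := by
    refine (Polynomial.natDegree_sub_le _ _).trans ?_
    simp
  have h3 := Polynomial.natDegree_pow_le_of_le (N - j) h2
  have h4 : ((N.choose j : Polynomial ℝ) * Polynomial.X ^ j).natDegree ≤ j := by
    refine Polynomial.natDegree_mul_le.trans ?_
    simp
  refine Polynomial.natDegree_mul_le.trans ?_
  omega

lemma derivative_bernSum (N : ℕ) (c : ℕ → ℝ) :
    Polynomial.derivative (bernSum (N + 1) c) =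
      Polynomial.C ((N : ℝ) + 1) * bernSum N (fwdDiff 1 c) := by
  have h0 : bernsteinPolynomial ℝ N (N + 1) = 0 :=
    bernsteinPolynomial.eq_zero_of_lt ℝ (Nat.lt_succ_self N)
  unfold bernSum fwdDiff
  rw [Finset.sum_range_succ', Polynomial.derivative_add, Polynomial.derivative_sum]
  simp only [Polynomial.derivative_C_mul, bernsteinPolynomial.derivative_succ,
    bernsteinPolynomial.derivative_zero, Nat.add_sub_cancel]
  have h1 : ∑ j ∈ Finset.range (N + 1), Polynomial.C (c (j + 1)) * bernsteinPolynomial ℝ N (j + 1)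
      + Polynomial.C (c 0) * bernsteinPolynomial ℝ N 0 =
      ∑ j ∈ Finset.range (N + 1), Polynomial.C (c j) * bernsteinPolynomial ℝ N j := by
    rw [← Finset.sum_range_succ' (fun j => Polynomial.C (c j) * bernsteinPolynomial ℝ N j),
      Finset.sum_range_succ, h0, mul_zero, add_zero]
  have h2 : ∀ j ∈ Finset.range (N + 1), Polynomial.C (c (j + 1)) * (((N + 1 : ℕ) : Polynomial ℝ) *
      (bernsteinPolynomial ℝ N j - bernsteinPolynomial ℝ N (j + 1))) =
      (N + 1) * (Polynomial.C (c (j + 1)) * bernsteinPolynomial ℝ N j) -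
      (N + 1) * (Polynomial.C (c (j + 1)) * bernsteinPolynomial ℝ N (j + 1)) := by
    intro j _
    push_cast
    ring
  rw [Finset.sum_congr rfl h2, Finset.sum_sub_distrib, ← Finset.mul_sum, ← Finset.mul_sum]
  simp only [Polynomial.C_sub, sub_mul, Finset.sum_sub_distrib]
  rw [← h1]
  simp only [map_add, map_natCast, map_one]
  push_cast
  ring

lemma iterate_derivative_bernSum (N k : ℕ) (c : ℕ → ℝ) :
    Polynomial.derivative^[k] (bernSum (N + k) c) =
      Polynomial.C ((N + k).descFactorial k : ℝ) * bernSum N ((fwdDiff 1)^[k] c) := by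
  induction k generalizing c with
  | zero => simp
  | succ k ih =>
    rw [Function.iterate_succ_apply, ← add_assoc, derivative_bernSum,
      Polynomial.iterate_derivative_C_mul, ih, ← mul_assoc, ← Polynomial.C_mul,
      Function.iterate_succ_apply, Nat.succ_descFactorial_succ]
    push_cast
    rfl

lemma integral_eval_derivative (p : Polynomial ℝ) :
    ∫ t in (0 : ℝ)..1, (Polynomial.derivative p).eval t = p.eval 1 - p.eval 0 :=
  intervalIntegral.integral_eq_sub_of_hasDerivAt (fun t _ => p.hasDerivAt t)
    ((Polynomial.continuous _).intervalIntegrable _ _)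

lemma integral_bern_mul_derivative (M i : ℕ) (q : Polynomial ℝ) :
    ∫ t in (0 : ℝ)..1, bern M i t * (Polynomial.derivative q).eval t =
      (if i = M then q.eval 1 else 0) - (if i = 0 then q.eval 0 else 0) -
      ∫ t in (0 : ℝ)..1, (Polynomial.derivative (bernsteinPolynomial ℝ M i)).eval t * q.eval t := by
  have h := integral_eval_derivative (bernsteinPolynomial ℝ M i * q)
  simp only [Polynomial.derivative_mul, Polynomial.eval_add, Polynomial.eval_mul,
    bernsteinPolynomial.eval_at_0, bernsteinPolynomial.eval_at_1] at h
  rw [intervalIntegral.integral_add (by apply Continuous.intervalIntegrable; fun_prop)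
    (by apply Continuous.intervalIntegrable; fun_prop)] at h
  simp only [bern_eq_eval]
  split_ifs at h ⊢ <;> linarith

lemma integral_bern_succ_sub (M i : ℕ) (hi : i + 1 ≤ M) (q : Polynomial ℝ) :
    ((M : ℝ) + 1) * ((∫ t in (0 : ℝ)..1, bern M (i + 1) t * q.eval t) -
      ∫ t in (0 : ℝ)..1, bern M i t * q.eval t) =
    ∫ t in (0 : ℝ)..1, bern (M + 1) (i + 1) t * (Polynomial.derivative q).eval t := by
  rw [integral_bern_mul_derivative, if_neg (by omega), if_neg (by omega),
    ← intervalIntegral.integral_sub (by apply Continuous.intervalIntegrable; fun_prop)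
    (by apply Continuous.intervalIntegrable; fun_prop), ← intervalIntegral.integral_const_mul,
    sub_zero, zero_sub, ← intervalIntegral.integral_neg]
  congr 1
  ext t
  rw [bernsteinPolynomial.derivative_succ]
  simp only [bern_eq_eval, Nat.add_sub_cancel, Polynomial.eval_mul, Polynomial.eval_sub,
    Polynomial.eval_natCast]
  push_cast
  ring

/-- The Bernstein coefficients of `Uop (m + 2) f`. -/
def durrCoeff (m : ℕ) (f : ℝ → ℝ) (j : ℕ) : ℝ :=
  if j = 0 then f 0 else if j = m + 2 then f 1 else
    ((m : ℝ) + 1) * ∫ t in (0 : ℝ)..1, bern m (j - 1) t * f t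

lemma Uop_eq_eval_bernSum (m : ℕ) (f : ℝ → ℝ) (x : ℝ) :
    Uop (m + 2) f x = (bernSum (m + 2) (durrCoeff m f)).eval x := by
  rw [eval_bernSum, Finset.sum_range_succ, Finset.sum_range_succ', Uop]
  have h : ∀ j ∈ Finset.range (m + 1), durrCoeff m f (j + 1) * bern (m + 2) (j + 1) x =
      ((m : ℝ) + 1) * (bern (m + 2) (j + 1) x * ∫ t in (0 : ℝ)..1, bern m j t * f t) := by
    intro j hj
    rw [Finset.mem_range] at hj
    rw [durrCoeff, if_neg (by omega), if_neg (by omega), Nat.add_sub_cancel]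
    ring
  rw [Finset.sum_congr rfl h, ← Finset.mul_sum]
  have h2 : ∑ k ∈ Finset.Icc 1 (m + 2 - 1), bern (m + 2) k x *
      ∫ t in (0 : ℝ)..1, bern (m + 2 - 2) (k - 1) t * f t =
      ∑ j ∈ Finset.range (m + 1), bern (m + 2) (j + 1) x * ∫ t in (0 : ℝ)..1, bern m j t * f t := by
    rw [show Finset.Icc 1 (m + 2 - 1) = Finset.Ico 1 (m + 2) from by ext; simp; omega,
      Finset.sum_Ico_eq_sum_range]
    refine Finset.sum_congr rfl fun j _ => ?_
    rw [add_comm 1 j, Nat.add_sub_cancel, Nat.add_sub_cancel]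
  rw [h2]
  simp [durrCoeff, bern]
  ring

lemma fwdDiff_durrCoeff (m j : ℕ) (hj : j ≤ m + 1) (q : Polynomial ℝ) :
    fwdDiff 1 (durrCoeff m q.eval) j =
      ∫ t in (0 : ℝ)..1, bern (m + 1) j t * (Polynomial.derivative q).eval t := by
  unfold fwdDiff
  rcases Nat.eq_zero_or_pos j with rfl | hj0
  · rw [integral_bern_mul_derivative, if_neg (by omega), if_pos rfl, durrCoeff, durrCoeff,
      if_neg (by omega), if_neg (by omega), if_pos rfl, ← intervalIntegral.integral_const_mul,
      zero_sub, sub_eq_add_neg, add_comm, sub_eq_add_neg, ← intervalIntegral.integral_neg]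
    congr 2
    ext t
    simp [bernsteinPolynomial.derivative_zero, bern_eq_eval]
    ring
  · obtain ⟨i, rfl⟩ : ∃ i, j = i + 1 := ⟨j - 1, by omega⟩
    rcases Nat.lt_or_ge i m with hi | hi
    · rw [← integral_bern_succ_sub m i hi, durrCoeff, durrCoeff, if_neg (by omega),
        if_neg (by omega), if_neg (by omega), if_neg (by omega)]
      simp only [Nat.add_sub_cancel]
      ring
    · obtain rfl : i = m := by omega
      rw [integral_bern_mul_derivative, if_pos rfl, if_neg (by omega), durrCoeff, durrCoeff,
        if_neg (by omega), if_pos (by omega), if_neg (by omega), if_neg (by omega),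
        ← intervalIntegral.integral_const_mul, sub_zero]
      congr 2
      ext t
      rw [bernsteinPolynomial.derivative_succ]
      simp [bern_eq_eval, bernsteinPolynomial.eq_zero_of_lt ℝ (Nat.lt_succ_self i)]
      ring

lemma iterate_fwdDiff_durrCoeff (m α j : ℕ) (hj : j + α ≤ m + 1) (q : Polynomial ℝ) :
    (fwdDiff 1)^[α + 1] (durrCoeff m q.eval) j =
      (m + 1).factorial / (m + 1 + α).factorial * ∫ t in (0 : ℝ)..1,
        bern (m + 1 + α) (j + α) t * (Polynomial.derivative^[α + 1] q).eval t := by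
  induction α generalizing j with
  | zero =>
    have : ((m + 1).factorial : ℝ) ≠ 0 := by positivity
    simp [fwdDiff_durrCoeff m j hj q, this]
  | succ α ih =>
    rw [Function.iterate_succ_apply', fwdDiff, ih (j + 1) (by omega), ih j (by omega), ← mul_sub,
      show j + 1 + α = j + α + 1 by ring, Function.iterate_succ_apply' _ (α + 1), ← add_assoc,
      ← add_assoc, ← integral_bern_succ_sub _ _ (by omega), Nat.factorial_succ (m + 1 + α)]
    have : ((m + 1 + α).factorial : ℝ) ≠ 0 := by positivity
    push_cast
    field_simp

lemma sum_bern_mul_bern (N α : ℕ) (x t : ℝ) :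
    ∑ j ∈ Finset.range (N + 1), bern N j x *
      ((N + α).factorial / (N + α + α).factorial * bern (N + α + α) (j + α) t) =
    (t * (1 - t)) ^ α * gegSum N α (x * t) ((1 - x) * (1 - t)) := by
  rw [gegSum, Finset.mul_sum]
  refine Finset.sum_congr rfl fun j hj => ?_
  have hj' : j ≤ N := Nat.lt_succ_iff.mp (Finset.mem_range.mp hj)
  unfold bern
  rw [Nat.cast_choose ℝ (show j + α ≤ N + α + α by omega),
    show N + α + α - (j + α) = N - j + α by omega, mul_pow, mul_pow, mul_pow, pow_add, pow_add]
  have h1 : ((N + α + α).factorial : ℝ) ≠ 0 := by positivity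
  field_simp

/-- Integral representation of the derivatives of `Uop (m + 2) q`. -/
lemma eval_iterate_derivative_bernSum_durrCoeff (m α : ℕ) (q : Polynomial ℝ) (x : ℝ) :
    (Polynomial.derivative^[α + 1] (bernSum (m + 2) (durrCoeff m q.eval))).eval x =
      (m + 2).descFactorial (α + 1) * ∫ t in (0 : ℝ)..1, (t * (1 - t)) ^ α *
        gegSum (m + 2 - (α + 1)) α (x * t) ((1 - x) * (1 - t)) *
          (Polynomial.derivative^[α + 1] q).eval t := by
  rcases Nat.lt_or_ge (m + 2) (α + 1) with h | h
  · rw [Polynomial.iterate_derivative_eq_zero ((natDegree_bernSum_le _ _).trans_lt h),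
      Nat.descFactorial_eq_zero_iff_lt.mpr h]
    simp
  · obtain ⟨N, hN⟩ : ∃ N, m + 2 = N + (α + 1) := ⟨m + 2 - (α + 1), by omega⟩
    have hN' : m + 1 = N + α := by omega
    rw [hN, iterate_derivative_bernSum, Polynomial.eval_mul, Polynomial.eval_C, eval_bernSum,
      Nat.add_sub_cancel]
    congr 1
    simp_rw [← sum_bern_mul_bern, Finset.sum_mul]
    rw [intervalIntegral.integral_finsetSum
      (fun i _ => by apply Continuous.intervalIntegrable; fun_prop)]
    refine Finset.sum_congr rfl fun j hj => ?_
    rw [Finset.mem_range] at hj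
    rw [iterate_fwdDiff_durrCoeff m α j (by omega), hN', ← intervalIntegral.integral_const_mul,
      ← intervalIntegral.integral_mul_const]
    congr 1
    ext t
    ring

lemma iterate_derivative_X_mul_succ (k : ℕ) (p : Polynomial ℝ) :
    Polynomial.derivative^[k + 1] (Polynomial.X * p) =
      Polynomial.X * Polynomial.derivative^[k + 1] p +
        ((k : Polynomial ℝ) + 1) * Polynomial.derivative^[k] p := by
  induction k with
  | zero => simp; ring
  | succ k ih =>
    rw [Function.iterate_succ_apply', ih, Function.iterate_succ_apply' _ (k + 1)]
    simp only [Polynomial.derivative_add, Polynomial.derivative_mul, Polynomial.derivative_X,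
      Polynomial.derivative_natCast, Polynomial.derivative_one,
      ← Function.iterate_succ_apply' (Polynomial.derivative)]
    push_cast
    ring

lemma iteratedDeriv_eval (p : Polynomial ℝ) (k : ℕ) :
    iteratedDeriv k (fun y => p.eval y) = fun y => (Polynomial.derivative^[k] p).eval y := by
  induction k with
  | zero => simp
  | succ k ih =>
    rw [iteratedDeriv_succ, ih, Function.iterate_succ_apply']
    ext y
    exact Polynomial.deriv _

/-- The antiderivative of `∑_{k ≤ n} a_k X^k` vanishing at `0`, where `a_k` are the coefficients
of `P`. -/
def antideriv (n : ℕ) (P : Polynomial ℝ) : Polynomial ℝ :=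
  ∑ k ∈ Finset.range (n + 1), Polynomial.C (P.coeff k / ((k : ℝ) + 1)) * Polynomial.X ^ (k + 1)

lemma derivative_antideriv {n : ℕ} {P : Polynomial ℝ} (hdeg : P.natDegree ≤ n) :
    Polynomial.derivative (antideriv n P) = P := by
  conv_rhs => rw [P.as_sum_range_C_mul_X_pow' (Nat.lt_succ_of_le hdeg)]
  rw [antideriv, Polynomial.derivative_sum]
  refine Finset.sum_congr rfl fun k _ => ?_
  rw [Polynomial.derivative_C_mul, Polynomial.derivative_X_pow, Nat.add_sub_cancel, ← mul_assoc,
    ← Polynomial.C_mul]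
  congr 2
  push_cast
  field_simp

lemma eval_antideriv_zero (n : ℕ) (P : Polynomial ℝ) : (antideriv n P).eval 0 = 0 := by
  simp [antideriv, Polynomial.eval_finsetSum]

lemma monotoneOn_eval {p : Polynomial ℝ} {a b : ℝ}
    (h : ∀ x ∈ Set.Icc a b, 0 ≤ (Polynomial.derivative p).eval x) :
    MonotoneOn (fun x => p.eval x) (Set.Icc a b) := by
  refine monotoneOn_of_deriv_nonneg (convex_Icc a b) p.continuous.continuousOn
    p.differentiable.differentiableOn fun x hx => ?_
  rw [Polynomial.deriv]
  exact h x (interior_subset hx)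

lemma sum_descFactorial_eq (n : ℕ) (P : Polynomial ℝ) (ν : ℕ) (y : ℝ) :
    ∑ k ∈ Finset.range (n + 1), P.coeff k / ((k : ℝ) + 1) * (k + 2).descFactorial ν *
        y ^ (k + 2 - ν) =
      (Polynomial.derivative^[ν] (Polynomial.X * antideriv n P)).eval y := by
  have h : Polynomial.X * antideriv n P = ∑ k ∈ Finset.range (n + 1),
      Polynomial.C (P.coeff k / ((k : ℝ) + 1)) * Polynomial.X ^ (k + 2) := by
    rw [antideriv, Finset.mul_sum]
    refine Finset.sum_congr rfl fun k _ => ?_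
    ring
  rw [h, Polynomial.iterate_derivative_sum, Polynomial.eval_finsetSum]
  refine Finset.sum_congr rfl fun k _ => ?_
  rw [Polynomial.iterate_derivative_C_mul, Polynomial.iterate_derivative_X_pow_eq_C_mul]
  simp
  ring

lemma sum_descFactorial_nonneg {r n : ℕ} {P : Polynomial ℝ} (hdeg : P.natDegree ≤ n)
    (hmon : ∀ ν ≤ r, ∀ x ∈ I01, 0 ≤ iteratedDeriv ν (fun y => P.eval y) x) {ν : ℕ}
    (hν : ν ≤ r + 1) {y : ℝ} (hy : y ∈ I01) :
    0 ≤ ∑ k ∈ Finset.range (n + 1), P.coeff k / ((k : ℝ) + 1) * (k + 2).descFactorial ν *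
        y ^ (k + 2 - ν) := by
  have hA : ∀ j ≤ r + 1, ∀ y ∈ I01, 0 ≤ (Polynomial.derivative^[j] (antideriv n P)).eval y := by
    intro j hj y hy
    rcases j with _ | j
    · have hm := monotoneOn_eval (p := antideriv n P) (a := 0) (b := 1) (fun x hx => by
        rw [derivative_antideriv hdeg]
        simpa using hmon 0 (Nat.zero_le _) x hx)
      have := hm ⟨le_rfl, zero_le_one⟩ hy hy.1
      simpa [eval_antideriv_zero] using this
    · rw [Function.iterate_succ_apply, derivative_antideriv hdeg]
      have := hmon j (by omega) y hy
      rwa [iteratedDeriv_eval] at this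
  rw [sum_descFactorial_eq]
  rcases ν with _ | k
  · simpa using mul_nonneg hy.1 (hA 0 (by omega) y hy)
  · rw [iterate_derivative_X_mul_succ]
    simp only [Polynomial.eval_add, Polynomial.eval_mul, Polynomial.eval_X,
      Polynomial.eval_natCast, Polynomial.eval_one]
    have h1 := hA (k + 1) hν y hy
    have h2 := hA k (by omega) y hy
    have h3 := hy.1
    positivity

lemma sum_coeff_div_eq_one {n : ℕ} {P : Polynomial ℝ} (hdeg : P.natDegree ≤ n)
    (hint : (∫ t in (0 : ℝ)..1, P.eval t) = 1) :
    ∑ k ∈ Finset.range (n + 1), P.coeff k / ((k : ℝ) + 1) = 1 := by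
  have h := integral_eval_derivative (antideriv n P)
  rw [derivative_antideriv hdeg, hint, eval_antideriv_zero] at h
  simp only [antideriv, Polynomial.eval_finsetSum, Polynomial.eval_mul, Polynomial.eval_C,
    Polynomial.eval_pow, Polynomial.eval_X, one_pow, mul_one, sub_zero] at h
  exact h.symm

/-- Gavrea's operator with values in polynomials. -/
def hopPoly (n : ℕ) (P : Polynomial ℝ) (f : ℝ → ℝ) : Polynomial ℝ :=
  ∑ k ∈ Finset.range (n + 1),
    Polynomial.C (P.coeff k / ((k : ℝ) + 1)) * bernSum (k + 2) (durrCoeff k f)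

lemma Hop_eq_eval (n : ℕ) (P : Polynomial ℝ) (f : ℝ → ℝ) (x : ℝ) :
    Hop n P f x = (hopPoly n P f).eval x := by
  simp [Hop, hopPoly, Polynomial.eval_finsetSum, Uop_eq_eval_bernSum]

lemma natDegree_hopPoly_le (n : ℕ) (P : Polynomial ℝ) (f : ℝ → ℝ) :
    (hopPoly n P f).natDegree ≤ n + 2 := by
  refine Polynomial.natDegree_sum_le_of_forall_le _ _ fun k hk => ?_
  rw [Finset.mem_range] at hk
  refine (Polynomial.natDegree_C_mul_le _ _).trans ((natDegree_bernSum_le _ _).trans ?_)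
  omega

lemma continuous_gegSum (N α : ℕ) (x : ℝ) :
    Continuous fun t => gegSum N α (x * t) ((1 - x) * (1 - t)) := by
  unfold gegSum
  fun_prop

lemma eval_iterate_derivative_hopPoly_nonneg {r n : ℕ} {P : Polynomial ℝ} (hdeg : P.natDegree ≤ n)
    (hmon : ∀ ν ≤ r, ∀ x ∈ I01, 0 ≤ iteratedDeriv ν (fun y => P.eval y) x) {α : ℕ} (hα : α ≤ r)
    (q : Polynomial ℝ) (hq : ∀ t ∈ I01, 0 ≤ (Polynomial.derivative^[α + 1] q).eval t)
    {x : ℝ} (hx : x ∈ I01) :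
    0 ≤ (Polynomial.derivative^[α + 1] (hopPoly n P q.eval)).eval x := by
  rw [hopPoly, Polynomial.iterate_derivative_sum, Polynomial.eval_finsetSum]
  simp_rw [Polynomial.iterate_derivative_C_mul, Polynomial.eval_mul, Polynomial.eval_C,
    eval_iterate_derivative_bernSum_durrCoeff, ← mul_assoc, ← intervalIntegral.integral_const_mul]
  rw [← intervalIntegral.integral_finsetSum]
  · refine intervalIntegral.integral_nonneg zero_le_one fun t ht => ?_
    have h := sum_mul_gegSum_nonneg (Finset.range (n + 1))
      (fun k => P.coeff k / ((k : ℝ) + 1) * (k + 2).descFactorial (α + 1))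
      (fun k => k + 2 - (α + 1)) α
      (fun y hy => sum_descFactorial_nonneg hdeg hmon (by omega) hy) hx ht
    have h2 : 0 ≤ t * (1 - t) := mul_nonneg ht.1 (by linarith [ht.2])
    refine le_of_le_of_eq (mul_nonneg (mul_nonneg (pow_nonneg h2 α) h) (hq t ht)) ?_
    rw [Finset.mul_sum, Finset.sum_mul]
    refine Finset.sum_congr rfl fun k _ => ?_
    ring
  · intro k _
    apply Continuous.intervalIntegrable
    have := continuous_gegSum (k + 2 - (α + 1)) α x
    fun_prop

lemma sum_bern_succ_mul_bern (m : ℕ) (x t : ℝ) :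
    ((m : ℝ) + 1) * ∑ j ∈ Finset.range (m + 1), bern (m + 2) (j + 1) x * bern m j t =
      x * (1 - x) * ((m + 2).descFactorial 2 * gegSum m 1 (x * t) ((1 - x) * (1 - t))) := by
  rw [gegSum, Finset.mul_sum, Finset.mul_sum, Finset.mul_sum]
  refine Finset.sum_congr rfl fun j hj => ?_
  have hj' : j ≤ m := Nat.lt_succ_iff.mp (Finset.mem_range.mp hj)
  unfold bern
  rw [Nat.cast_choose ℝ (show j + 1 ≤ m + 2 by omega), show m + 2 - (j + 1) = m - j + 1 by omega,
    show (m + 2).descFactorial 2 = (m + 1) * (m + 2) by simp [Nat.descFactorial],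
    show m + 2 = m + 1 + 1 by ring, Nat.factorial_succ (m + 1), mul_pow, mul_pow, pow_succ, pow_succ]
  push_cast
  field_simp

lemma ContinuousOn.intervalIntegrable_mul {f g : ℝ → ℝ} (hf : ContinuousOn f I01)
    (hg : Continuous g) :
    IntervalIntegrable (fun t => g t * f t) MeasureTheory.volume 0 1 := by
  apply ContinuousOn.intervalIntegrable
  rw [Set.uIcc_of_le zero_le_one]
  exact hg.continuousOn.mul hf

/-- Kernel representation of Gavrea's operator. -/
lemma Hop_eq_integral (n : ℕ) (P : Polynomial ℝ) {f : ℝ → ℝ} (hf : ContinuousOn f I01) (x : ℝ) :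
    Hop n P f x =
      f 0 * (∑ k ∈ Finset.range (n + 1), P.coeff k / ((k : ℝ) + 1) * (1 - x) ^ (k + 2)) +
      f 1 * (∑ k ∈ Finset.range (n + 1), P.coeff k / ((k : ℝ) + 1) * x ^ (k + 2)) +
      ∫ t in (0 : ℝ)..1, x * (1 - x) * (∑ k ∈ Finset.range (n + 1), P.coeff k / ((k : ℝ) + 1) *
        (k + 2).descFactorial 2 * gegSum k 1 (x * t) ((1 - x) * (1 - t))) * f t := by
  have h1 : ∀ t, x * (1 - x) * (∑ k ∈ Finset.range (n + 1), P.coeff k / ((k : ℝ) + 1) *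
      (k + 2).descFactorial 2 * gegSum k 1 (x * t) ((1 - x) * (1 - t))) * f t =
      ∑ k ∈ Finset.range (n + 1), P.coeff k / ((k : ℝ) + 1) * (((k : ℝ) + 1) *
        ∑ j ∈ Finset.range (k + 1), bern (k + 2) (j + 1) x * (bern k j t * f t)) := by
    intro t
    rw [Finset.mul_sum, Finset.sum_mul]
    refine Finset.sum_congr rfl fun k _ => ?_
    simp_rw [← mul_assoc (bern _ _ _)]
    rw [← Finset.sum_mul, ← mul_assoc ((k : ℝ) + 1), sum_bern_succ_mul_bern]
    ring
  have hI : ∀ k j : ℕ, IntervalIntegrable (fun t => bern k j t * f t) MeasureTheory.volume 0 1 :=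
    fun k j => hf.intervalIntegrable_mul (continuous_bern k j)
  simp_rw [h1]
  rw [intervalIntegral.integral_finsetSum]
  · rw [Finset.mul_sum, Finset.mul_sum, ← Finset.sum_add_distrib, ← Finset.sum_add_distrib, Hop]
    refine Finset.sum_congr rfl fun k _ => ?_
    rw [intervalIntegral.integral_const_mul, intervalIntegral.integral_const_mul,
      intervalIntegral.integral_finsetSum (fun j _ => (hI k j).const_mul _), Uop,
      show Finset.Icc 1 (k + 2 - 1) = Finset.Ico 1 (k + 2) from by ext; simp; omega,
      Finset.sum_Ico_eq_sum_range]
    simp_rw [intervalIntegral.integral_const_mul, add_comm 1, Nat.add_sub_cancel]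
    push_cast
    ring
  · intro k _
    refine IntervalIntegrable.const_mul (IntervalIntegrable.const_mul ?_ _) _
    have h := IntervalIntegrable.sum (μ := MeasureTheory.volume) (a := 0) (b := 1)
      (Finset.range (k + 1)) (f := fun j t => bern (k + 2) (j + 1) x * (bern k j t * f t))
      (fun j _ => (hI k j).const_mul _)
    rwa [show ∑ j ∈ Finset.range (k + 1),
        (fun t => bern (k + 2) (j + 1) x * (bern k j t * f t)) = fun t =>
          ∑ j ∈ Finset.range (k + 1), bern (k + 2) (j + 1) x * (bern k j t * f t) from
      funext fun t => Finset.sum_apply _ _ _] at h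

lemma Hop_nonneg {r n : ℕ} (hr : 1 ≤ r) {P : Polynomial ℝ} (hdeg : P.natDegree ≤ n)
    (hmon : ∀ ν ≤ r, ∀ x ∈ I01, 0 ≤ iteratedDeriv ν (fun y => P.eval y) x) {f : ℝ → ℝ}
    (hf : ContinuousOn f I01) (hf0 : ∀ x ∈ I01, 0 ≤ f x) {x : ℝ} (hx : x ∈ I01) :
    0 ≤ Hop n P f x := by
  have hx' : 1 - x ∈ I01 := ⟨by linarith [hx.2], by linarith [hx.1]⟩
  have h1 := sum_descFactorial_nonneg hdeg hmon (Nat.zero_le _) hx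
  have h2 := sum_descFactorial_nonneg hdeg hmon (Nat.zero_le _) hx'
  simp only [Nat.descFactorial_zero, Nat.cast_one, mul_one, Nat.sub_zero] at h1 h2
  rw [Hop_eq_integral n P hf]
  refine add_nonneg (add_nonneg (mul_nonneg (hf0 0 ⟨le_rfl, zero_le_one⟩) h2)
    (mul_nonneg (hf0 1 ⟨zero_le_one, le_rfl⟩) h1)) ?_
  refine intervalIntegral.integral_nonneg zero_le_one fun t ht => ?_
  refine mul_nonneg (mul_nonneg (mul_nonneg hx.1 hx'.1) ?_) (hf0 t ht)
  exact sum_mul_gegSum_nonneg (Finset.range (n + 1))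
      (fun k => P.coeff k / ((k : ℝ) + 1) * (k + 2).descFactorial 2) (fun k => k) 1
      (fun y hy => sum_descFactorial_nonneg hdeg hmon (by omega) hy) hx ht

lemma Hop_add (n : ℕ) (P : Polynomial ℝ) {f g : ℝ → ℝ} (hf : ContinuousOn f I01)
    (hg : ContinuousOn g I01) (x : ℝ) :
    Hop n P (fun y => f y + g y) x = Hop n P f x + Hop n P g x := by
  simp only [Hop, Uop]
  rw [← Finset.sum_add_distrib]
  refine Finset.sum_congr rfl fun k _ => ?_
  rw [← mul_add]
  congr 1
  have : ∀ a b : ℕ, ∫ t in (0 : ℝ)..1, bern a b t * (f t + g t) =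
      (∫ t in (0 : ℝ)..1, bern a b t * f t) + ∫ t in (0 : ℝ)..1, bern a b t * g t := by
    intro a b
    simp_rw [mul_add]
    exact intervalIntegral.integral_add (hf.intervalIntegrable_mul (continuous_bern a b))
      (hg.intervalIntegrable_mul (continuous_bern a b))
  simp_rw [this, mul_add, Finset.sum_add_distrib]
  ring

lemma Hop_const_mul (n : ℕ) (P : Polynomial ℝ) (a : ℝ) (f : ℝ → ℝ) (x : ℝ) :
    Hop n P (fun y => a * f y) x = a * Hop n P f x := by
  simp only [Hop, Uop]
  rw [Finset.mul_sum]
  refine Finset.sum_congr rfl fun k _ => ?_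
  simp_rw [mul_left_comm _ a, intervalIntegral.integral_const_mul, mul_left_comm _ a,
    ← Finset.mul_sum]
  ring

lemma integral_bern (M j : ℕ) (hj : j ≤ M) :
    ((M : ℝ) + 1) * ∫ t in (0 : ℝ)..1, bern M j t = 1 := by
  induction j with
  | zero =>
    have h := integral_bern_mul_derivative (M + 1) 0 1
    simp [bernsteinPolynomial.derivative_zero, ← bern_eq_eval] at h
    linarith
  | succ j ih =>
    have h := integral_bern_succ_sub M j hj 1
    simp at h
    have : (M : ℝ) + 1 ≠ 0 := by positivity
    rcases h with h | h
    · exact absurd h this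
    · rw [sub_eq_zero.mp h, ih (by omega)]

lemma bern_mul_self (M j : ℕ) (t : ℝ) :
    ((M : ℝ) + 1) * (bern M j t * t) = (j + 1) * bern (M + 1) (j + 1) t := by
  have h : ((M : ℝ) + 1) * M.choose j = (M + 1).choose (j + 1) * (j + 1) := by
    exact_mod_cast Nat.add_one_mul_choose_eq M j
  unfold bern
  rw [Nat.add_sub_add_right, pow_succ]
  linear_combination (t ^ j * (1 - t) ^ (M - j) * t) * h

lemma integral_bern_mul_self (M j : ℕ) (hj : j ≤ M) :
    ((M : ℝ) + 1) * (M + 2) * ∫ t in (0 : ℝ)..1, bern M j t * t = j + 1 := by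
  have h := integral_bern (M + 1) (j + 1) (by omega)
  have h2 : ((M : ℝ) + 1) * ∫ t in (0 : ℝ)..1, bern M j t * t =
      (j + 1) * ∫ t in (0 : ℝ)..1, bern (M + 1) (j + 1) t := by
    rw [← intervalIntegral.integral_const_mul, ← intervalIntegral.integral_const_mul]
    simp_rw [bern_mul_self M j]
  push_cast at h
  linear_combination ((M : ℝ) + 2) * h2 + (j + 1) * h

lemma integral_bern_mul_sq (M j : ℕ) (hj : j ≤ M) :
    ((M : ℝ) + 1) * (M + 2) * (M + 3) * ∫ t in (0 : ℝ)..1, bern M j t * t ^ 2 =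
      (j + 1) * (j + 2) := by
  have h := integral_bern_mul_self (M + 1) (j + 1) (by omega)
  have h2 : ((M : ℝ) + 1) * ∫ t in (0 : ℝ)..1, bern M j t * t ^ 2 =
      (j + 1) * ∫ t in (0 : ℝ)..1, bern (M + 1) (j + 1) t * t := by
    rw [← intervalIntegral.integral_const_mul, ← intervalIntegral.integral_const_mul]
    congr 1
    ext t
    have := bern_mul_self M j t
    linear_combination t * this
  push_cast at h
  linear_combination ((M : ℝ) + 2) * (M + 3) * h2 + (j + 1) * h

lemma sum_bern (N : ℕ) (x : ℝ) : ∑ j ∈ Finset.range (N + 1), bern N j x = 1 := by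
  have := congrArg (Polynomial.eval x) (bernsteinPolynomial.sum ℝ N)
  simpa [Polynomial.eval_finsetSum, ← bern_eq_eval] using this

lemma sum_natCast_mul_bern (N : ℕ) (x : ℝ) :
    ∑ j ∈ Finset.range (N + 1), (j : ℝ) * bern N j x = N * x := by
  have := congrArg (Polynomial.eval x) (bernsteinPolynomial.sum_smul ℝ N)
  simpa [Polynomial.eval_finsetSum, ← bern_eq_eval] using this

lemma sum_natCast_mul_pred_mul_bern (N : ℕ) (x : ℝ) :
    ∑ j ∈ Finset.range (N + 1), (j : ℝ) * (j - 1) * bern N j x = N * (N - 1) * x ^ 2 := by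
  have h := congrArg (Polynomial.eval x) (bernsteinPolynomial.sum_mul_smul ℝ N)
  have hc : ∀ j : ℕ, (j : ℝ) * ((j - 1 : ℕ) : ℝ) = j * (j - 1) := by
    intro j
    rcases j with _ | j <;> simp
  simpa [Polynomial.eval_finsetSum, ← bern_eq_eval, hc] using h

lemma durrCoeff_one (m j : ℕ) (hj : j ≤ m + 2) : durrCoeff m (fun _ => 1) j = 1 := by
  unfold durrCoeff
  split_ifs
  · rfl
  · rfl
  · simpa using integral_bern m (j - 1) (by omega)

lemma durrCoeff_id (m j : ℕ) (hj : j ≤ m + 2) :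
    durrCoeff m (fun y => y) j = j / ((m : ℝ) + 2) := by
  unfold durrCoeff
  split_ifs with h1 h2
  · simp [h1]
  · rw [h2]
    push_cast
    rw [div_self (by positivity)]
  · have h := integral_bern_mul_self m (j - 1) (by omega)
    rw [eq_div_iff (by positivity)]
    rw [Nat.cast_sub (by omega)] at h
    push_cast at h
    linarith

lemma durrCoeff_sq (m j : ℕ) (hj : j ≤ m + 2) :
    durrCoeff m (fun y => y ^ 2) j = j * (j + 1) / (((m : ℝ) + 2) * (m + 3)) := by
  unfold durrCoeff
  split_ifs with h1 h2
  · simp [h1]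
  · rw [h2, eq_div_iff (by positivity)]
    push_cast
    ring
  · have h := integral_bern_mul_sq m (j - 1) (by omega)
    rw [eq_div_iff (by positivity)]
    rw [Nat.cast_sub (by omega)] at h
    push_cast at h
    linarith

lemma Uop_one (m : ℕ) (x : ℝ) : Uop (m + 2) (fun _ => 1) x = 1 := by
  rw [Uop_eq_eval_bernSum, eval_bernSum]
  refine Eq.trans (Finset.sum_congr rfl fun j hj => ?_) (sum_bern (m + 2) x)
  rw [durrCoeff_one m j (Nat.lt_succ_iff.mp (Finset.mem_range.mp hj)), one_mul]

lemma Uop_id (m : ℕ) (x : ℝ) : Uop (m + 2) (fun y => y) x = x := by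
  have h := sum_natCast_mul_bern (m + 2) x
  have h2 : Uop (m + 2) (fun y => y) x =
      (∑ j ∈ Finset.range (m + 2 + 1), (j : ℝ) * bern (m + 2) j x) / (m + 2) := by
    rw [Uop_eq_eval_bernSum, eval_bernSum, Finset.sum_div]
    refine Finset.sum_congr rfl fun j hj => ?_
    rw [durrCoeff_id m j (Nat.lt_succ_iff.mp (Finset.mem_range.mp hj))]
    ring
  rw [h2, h]
  push_cast
  field_simp

lemma Uop_sq (m : ℕ) (x : ℝ) :
    Uop (m + 2) (fun y => y ^ 2) x = x ^ 2 + x * (1 - x) * (2 / ((m : ℝ) + 3)) := by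
  have h := sum_natCast_mul_bern (m + 2) x
  have h' := sum_natCast_mul_pred_mul_bern (m + 2) x
  have h2 : Uop (m + 2) (fun y => y ^ 2) x =
      (∑ j ∈ Finset.range (m + 2 + 1), (j : ℝ) * (j - 1) * bern (m + 2) j x +
        2 * ∑ j ∈ Finset.range (m + 2 + 1), (j : ℝ) * bern (m + 2) j x) /
          ((m + 2) * (m + 3)) := by
    rw [Uop_eq_eval_bernSum, eval_bernSum, Finset.mul_sum, ← Finset.sum_add_distrib,
      Finset.sum_div]
    refine Finset.sum_congr rfl fun j hj => ?_
    rw [durrCoeff_sq m j (Nat.lt_succ_iff.mp (Finset.mem_range.mp hj))]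
    ring
  rw [h2, h, h']
  push_cast
  field_simp
  ring

lemma Hop_one {n : ℕ} {P : Polynomial ℝ} (hdeg : P.natDegree ≤ n)
    (hint : (∫ t in (0 : ℝ)..1, P.eval t) = 1) (x : ℝ) : Hop n P (fun _ => 1) x = 1 := by
  simp only [Hop, Uop_one, mul_one, sum_coeff_div_eq_one hdeg hint]

lemma Hop_id {n : ℕ} {P : Polynomial ℝ} (hdeg : P.natDegree ≤ n)
    (hint : (∫ t in (0 : ℝ)..1, P.eval t) = 1) (x : ℝ) : Hop n P (fun y => y) x = x := by
  simp only [Hop, Uop_id, ← Finset.sum_mul, sum_coeff_div_eq_one hdeg hint, one_mul]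

lemma Hop_sq {n : ℕ} {P : Polynomial ℝ} (hdeg : P.natDegree ≤ n)
    (hint : (∫ t in (0 : ℝ)..1, P.eval t) = 1) (x : ℝ) :
    Hop n P (fun y => y ^ 2) x =
      x ^ 2 + x * (1 - x) * (1 - ∫ t in (0 : ℝ)..1, t ^ 2 * P.eval t) := by
  have h1 : ∫ t in (0 : ℝ)..1, t ^ 2 * P.eval t =
      ∑ k ∈ Finset.range (n + 1), P.coeff k / ((k : ℝ) + 3) := by
    have : ∀ t : ℝ, t ^ 2 * P.eval t =
        ∑ k ∈ Finset.range (n + 1), P.coeff k * t ^ (k + 2) := by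
      intro t
      rw [Polynomial.eval_eq_sum_range' (Nat.lt_succ_of_le hdeg), Finset.mul_sum]
      exact Finset.sum_congr rfl fun k _ => by ring
    simp_rw [this]
    rw [intervalIntegral.integral_finsetSum
      (fun k _ => by apply Continuous.intervalIntegrable; fun_prop)]
    refine Finset.sum_congr rfl fun k _ => ?_
    rw [intervalIntegral.integral_const_mul, integral_pow]
    push_cast
    simp
    ring
  have h2 := sum_coeff_div_eq_one hdeg hint
  calc Hop n P (fun y => y ^ 2) x = (∑ k ∈ Finset.range (n + 1), P.coeff k / ((k : ℝ) + 1)) * x ^ 2 +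
      x * (1 - x) * (∑ k ∈ Finset.range (n + 1), P.coeff k / ((k : ℝ) + 1) -
        ∑ k ∈ Finset.range (n + 1), P.coeff k / ((k : ℝ) + 3)) := ?_
    _ = _ := by rw [h1, h2, one_mul]
  rw [← Finset.sum_sub_distrib, Finset.sum_mul, Finset.mul_sum, ← Finset.sum_add_distrib, Hop]
  refine Finset.sum_congr rfl fun k _ => ?_
  rw [Uop_sq]
  field_simp
  ring

lemma iterate_fwdDiff_eval_nonneg (k : ℕ) (h : ℝ) (hh : 0 ≤ h) (p : Polynomial ℝ) (a b : ℝ)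
    (hp : ∀ y ∈ Set.Icc a b, 0 ≤ (Polynomial.derivative^[k] p).eval y)
    (y : ℝ) (hya : a ≤ y) (hyb : y + k * h ≤ b) : 0 ≤ (fwdDiff h)^[k] (fun z => p.eval z) y := by
  induction k generalizing p b with
  | zero => simpa using hp y ⟨hya, by simpa using hyb⟩
  | succ k ih =>
    push_cast at hyb
    set S : Polynomial ℝ := Polynomial.X + Polynomial.C h with hS
    have h1 : fwdDiff h (fun z => p.eval z) = fun z => (p.comp S - p).eval z := by
      ext z
      simp [fwdDiff, hS]
    have hder : ∀ (j : ℕ) (q : Polynomial ℝ),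
        Polynomial.derivative^[j] (q.comp S) = (Polynomial.derivative^[j] q).comp S := by
      intro j
      induction j with
      | zero => intro q; rfl
      | succ j ihj =>
        intro q
        rw [Function.iterate_succ_apply, Polynomial.derivative_comp, Function.iterate_succ_apply,
          ← ihj]
        simp [hS]
    rw [Function.iterate_succ_apply, h1]
    refine ih (p.comp S - p) (b - h) (fun z hz => ?_) (by linarith)
    have hm := monotoneOn_eval (p := Polynomial.derivative^[k] p) (a := a) (b := b)
      (fun x hx => by rw [← Function.iterate_succ_apply' Polynomial.derivative]; exact hp x hx)
    rw [Polynomial.iterate_derivative_sub, hder, Polynomial.eval_sub, Polynomial.eval_comp]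
    have : S.eval z = z + h := by simp [hS]
    rw [this, sub_nonneg]
    exact hm ⟨hz.1, by linarith [hz.2]⟩ ⟨by linarith [hz.1], by linarith [hz.2]⟩ (by linarith)

lemma centralDiff_eq_iterate_fwdDiff {k : ℕ} {δ x : ℝ} (f : ℝ → ℝ)
    (h : (x - k * δ / 2) ∈ I01 ∧ (x + k * δ / 2) ∈ I01) :
    centralDiff k δ f x = (fwdDiff δ)^[k] f (x - k * δ / 2) := by
  rw [centralDiff, if_pos h, fwdDiff_iter_eq_sum_shift]
  refine Finset.sum_congr rfl fun i _ => ?_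
  simp only [zsmul_eq_mul, nsmul_eq_mul]
  push_cast
  ring

lemma kMono_eval {k : ℕ} {p : Polynomial ℝ}
    (hp : ∀ y ∈ I01, 0 ≤ (Polynomial.derivative^[k] p).eval y) : kMono k (fun x => p.eval x) := by
  intro δ hδ x _
  by_cases h : (x - k * δ / 2) ∈ I01 ∧ (x + k * δ / 2) ∈ I01
  · rw [centralDiff_eq_iterate_fwdDiff _ h]
    exact iterate_fwdDiff_eval_nonneg k δ hδ.le p 0 1 hp _ h.1.1 (by linarith [h.2.2])
  · rw [centralDiff, if_neg h]

lemma kMono.iterate_fwdDiff_nonneg {k : ℕ} {f : ℝ → ℝ} (hf : kMono k f) {N j : ℕ} (hN : 0 < N)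
    (hj : j + k ≤ N) : 0 ≤ (fwdDiff 1)^[k] (fun i : ℕ => f (i / N)) j := by
  have hN' : (0 : ℝ) < N := by exact_mod_cast hN
  have hj' : (j : ℝ) + k ≤ N := by exact_mod_cast hj
  have hx1 : (j : ℝ) / N + k * (1 / N) / 2 - k * (1 / N) / 2 = j / N := by ring
  have hx2 : (j : ℝ) / N + k * (1 / N) / 2 + k * (1 / N) / 2 = (j + k) / N := by ring
  have h0 : (0 : ℝ) ≤ j / N := by positivity
  have h1 : ((j : ℝ) + k) / N ≤ 1 := (div_le_one hN').mpr hj'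
  have h2 : (0 : ℝ) ≤ k * (1 / N) / 2 := by positivity
  have h := hf (1 / N) (by positivity) (j / N + k * (1 / N) / 2) ⟨by positivity, by linarith⟩
  rw [centralDiff_eq_iterate_fwdDiff _ ⟨by rw [hx1]; exact ⟨h0, by linarith⟩,
    by rw [hx2]; exact ⟨by positivity, h1⟩⟩, hx1, fwdDiff_iter_eq_sum_shift] at h
  rw [fwdDiff_iter_eq_sum_shift]
  refine le_of_le_of_eq h (Finset.sum_congr rfl fun i _ => ?_)
  congr 2
  simp
  ring

/-- Bernstein polynomials inherit `k`-monotonicity. -/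
lemma kMono.iterate_derivative_bernSum_nonneg {k : ℕ} {f : ℝ → ℝ} (hf : kMono k f) (M : ℕ)
    (hM : 0 < M) {y : ℝ} (hy : y ∈ I01) :
    0 ≤ (Polynomial.derivative^[k] (bernSum (M + k) fun i => f (i / (M + k : ℕ)))).eval y := by
  rw [iterate_derivative_bernSum, Polynomial.eval_mul, Polynomial.eval_C, eval_bernSum]
  refine mul_nonneg (Nat.cast_nonneg _) (Finset.sum_nonneg fun j hj => ?_)
  rw [Finset.mem_range] at hj
  exact mul_nonneg (hf.iterate_fwdDiff_nonneg (by omega) (by omega)) (bern_nonneg _ _ hy)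

lemma exists_bernSum_close {f : ℝ → ℝ} (hf : ContinuousOn f I01) {ε : ℝ} (hε : 0 < ε) :
    ∃ N₀ : ℕ, ∀ N ≥ N₀, ∀ y ∈ I01, |(bernSum N fun i => f (i / N)).eval y - f y| ≤ ε := by
  have hF : Continuous (Set.domRestrict I01 f) := continuousOn_iff_continuous_domRestrict.mp hf
  let F : C(unitInterval, ℝ) := ⟨Set.domRestrict I01 f, hF⟩
  have h := bernsteinApproximation_uniform F
  rw [Metric.tendsto_atTop] at h
  obtain ⟨N₀, hN₀⟩ := h ε hε
  refine ⟨N₀, fun N hN y hy => ?_⟩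
  have h1 := (ContinuousMap.dist_apply_le_dist (f := bernsteinApproximation N F) (g := F)
    ⟨y, hy⟩).trans (hN₀ N hN).le
  rw [Real.dist_eq, bernsteinApproximation.apply] at h1
  refine le_of_eq_of_le (congrArg (fun z => |z - f y|) ?_) h1
  rw [eval_bernSum, Finset.sum_range]
  refine Finset.sum_congr rfl fun j _ => ?_
  rw [bernstein_apply, smul_eq_mul, mul_comm]
  rfl

lemma abs_Hop_sub_le {r n : ℕ} (hr : 1 ≤ r) {P : Polynomial ℝ} (hdeg : P.natDegree ≤ n)
    (hmon : ∀ ν ≤ r, ∀ x ∈ I01, 0 ≤ iteratedDeriv ν (fun y => P.eval y) x)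
    (hint : (∫ t in (0 : ℝ)..1, P.eval t) = 1) {f g : ℝ → ℝ} (hf : ContinuousOn f I01)
    (hg : ContinuousOn g I01) {ε : ℝ} (hfg : ∀ y ∈ I01, |g y - f y| ≤ ε) {x : ℝ} (hx : x ∈ I01) :
    |Hop n P g x - Hop n P f x| ≤ ε := by
  have key : ∀ f g : ℝ → ℝ, ContinuousOn f I01 → ContinuousOn g I01 →
      (∀ y ∈ I01, g y ≤ f y + ε) → Hop n P g x ≤ Hop n P f x + ε := by
    intro f g hf hg h
    have hc : ContinuousOn (fun y => f y + ε * 1) I01 := hf.add continuousOn_const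
    have hg' : ContinuousOn (fun y => (-1) * g y) I01 := continuousOn_const.mul hg
    have h1 := Hop_nonneg hr hdeg hmon (f := fun y => f y + ε * 1 + -1 * g y) (hc.add hg') (fun y hy => by linarith [h y hy]) hx
    rw [Hop_add n P hc hg', Hop_add n P hf continuousOn_const, Hop_const_mul, Hop_const_mul,
      Hop_one hdeg hint] at h1
    linarith
  rw [abs_le]
  constructor
  · linarith [key g f hg hf fun y hy => by linarith [(abs_le.mp (hfg y hy)).1]]
  · linarith [key f g hf hg fun y hy => by linarith [(abs_le.mp (hfg y hy)).2]]

/-- `k`-monotonicity is closed under pointwise limits on `[0,1]`. -/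
lemma kMono_of_tendsto {k : ℕ} {F : ℕ → ℝ → ℝ} {g : ℝ → ℝ} (hF : ∀ M, kMono k (F M))
    (hlim : ∀ y ∈ I01, Filter.Tendsto (fun M => F M y) Filter.atTop (nhds (g y))) :
    kMono k g := by
  intro δ hδ x hx
  by_cases h : (x - k * δ / 2) ∈ I01 ∧ (x + k * δ / 2) ∈ I01
  · refine ge_of_tendsto' (f := fun M => centralDiff k δ (F M) x) (x := Filter.atTop) ?_
      fun M => hF M δ hδ x hx
    simp only [centralDiff, if_pos h]
    refine tendsto_finsetSum _ fun i hi => (hlim _ ?_).const_mul _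
    have hi' : (i : ℝ) ≤ k := by
      exact_mod_cast Nat.lt_succ_iff.mp (Finset.mem_range.mp hi)
    have h1 : 0 ≤ (i : ℝ) * δ := by positivity
    have h2 : (i : ℝ) * δ ≤ k * δ := mul_le_mul_of_nonneg_right hi' hδ.le
    exact ⟨by linarith [h.1.1], by linarith [h.2.2]⟩
  · rw [centralDiff, if_neg h]

lemma kMono_Hop {r n : ℕ} (hr : 1 ≤ r) {P : Polynomial ℝ} (hdeg : P.natDegree ≤ n)
    (hmon : ∀ ν ≤ r, ∀ x ∈ I01, 0 ≤ iteratedDeriv ν (fun y => P.eval y) x)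
    (hint : (∫ t in (0 : ℝ)..1, P.eval t) = 1) {k : ℕ} (hk : k ≤ r + 1) {f : ℝ → ℝ}
    (hf : ContinuousOn f I01) (hfk : kMono k f) : kMono k (Hop n P f) := by
  set p : ℕ → Polynomial ℝ := fun M => bernSum (M + 1 + k) fun i => f (i / (M + 1 + k : ℕ))
  refine kMono_of_tendsto (F := fun M => Hop n P (p M).eval) (fun M => ?_) fun y hy => ?_
  · have hp : ∀ y ∈ I01, 0 ≤ (Polynomial.derivative^[k] (p M)).eval y := fun y hy =>
      hfk.iterate_derivative_bernSum_nonneg (M + 1) (Nat.succ_pos M) hy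
    rw [show Hop n P (p M).eval = fun x => (hopPoly n P (p M).eval).eval x from
      funext fun x => Hop_eq_eval n P _ x]
    refine kMono_eval fun y hy => ?_
    rcases k with _ | α
    · rw [Function.iterate_zero_apply, ← Hop_eq_eval]
      exact Hop_nonneg hr hdeg hmon (p M).continuous.continuousOn hp hy
    · exact eval_iterate_derivative_hopPoly_nonneg hdeg hmon (by omega) (p M) hp hy
  · rw [Metric.tendsto_atTop]
    intro ε hε
    obtain ⟨N₀, hN₀⟩ := exists_bernSum_close hf (half_pos hε)
    refine ⟨N₀, fun M hM => ?_⟩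
    rw [Real.dist_eq]
    exact (abs_Hop_sub_le hr hdeg hmon hint hf (p M).continuous.continuousOn
      (hN₀ (M + 1 + k) (by omega)) hy).trans_lt (half_lt_self hε)


theorem statement11 (r n : ℕ) (hr : 1 ≤ r) (hn : 1 ≤ n)
    (P : Polynomial ℝ) (hdeg : P.natDegree ≤ n)
    (hmon : ∀ ν ≤ r, ∀ x ∈ I01, 0 ≤ iteratedDeriv ν (fun y => P.eval y) x)
    (hint : (∫ t in (0 : ℝ)..1, P.eval t) = 1) :
    ((∀ f g, ContinuousOn f I01 → ContinuousOn g I01 → ∀ x ∈ I01,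
        Hop n P (fun y => f y + g y) x = Hop n P f x + Hop n P g x) ∧
      (∀ (a : ℝ) (f), ContinuousOn f I01 → ∀ x ∈ I01,
        Hop n P (fun y => a * f y) x = a * Hop n P f x) ∧
      (∀ f, ContinuousOn f I01 → IsPolyOfDegLe (n + 2) (Hop n P f)) ∧
      (∀ f, ContinuousOn f I01 → (∀ x ∈ I01, 0 ≤ f x) → ∀ x ∈ I01, 0 ≤ Hop n P f x) ∧
      (∀ a b : ℝ, ∀ x ∈ I01, Hop n P (fun y => a + b * y) x = a + b * x)) ∧
    (∀ x ∈ I01, Hop n P (fun y => y ^ 2) x =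
        x ^ 2 + x * (1 - x) * (1 - ∫ t in (0 : ℝ)..1, t ^ 2 * P.eval t)) ∧
    (∀ k ≤ r + 1, ∀ f, ContinuousOn f I01 → kMono k f → kMono k (Hop n P f)) := by
  refine ⟨⟨fun f g hf hg x _ => Hop_add n P hf hg x, fun a f _ x _ => Hop_const_mul n P a f x,
    fun f _ => ⟨hopPoly n P f, natDegree_hopPoly_le n P f, Hop_eq_eval n P f⟩,
    fun f hf hf0 x hx => Hop_nonneg hr hdeg hmon hf hf0 hx, fun a b x _ => ?_⟩,
    fun x _ => Hop_sq hdeg hint x,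
    fun k hk f hf hfk => kMono_Hop hr hdeg hmon hint hk hf hfk⟩
  have h := Hop_add n P (f := fun _ => a * 1) (g := fun y => b * y) continuousOn_const
    (continuousOn_const.mul continuousOn_id) x
  rw [Hop_const_mul, Hop_const_mul, Hop_one hdeg hint, Hop_id hdeg hint] at h
  simpa using h
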